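/- Let ξ = exp(2πi/11), ν = (−1+i√11)/2, ℤ[ν] = {a + bν : a, b ∈ ℤ} ⊂ ℂ, and for k ∈ ℤ let ℓ_k : ℂ⁵ → ℂ be the linear form ℓ_k(z) = ξ^k z₁ + ξ^{9k} z₂ + ξ^{3k} z₃ + ξ^{4k} z₄ + ξ^{5k} z₅. If z ∈ ℂ⁵ satisfies ℓ_k(z) ∈ ℤ[ν] for k = 0, 1, 2, 3, 4, then ℓ_k(z) ∈ ℤ[ν] for every integer k. Equivalently, the lattice Λ₄ = {z ∈ ℂ⁵ : ℓ_k(z) ∈ ℤ[ν], 0 ≤ k ≤ 4} is stable under the diagonal linear map M_τ = diag(ξ, ξ⁹, ξ³, ξ⁴, ξ⁵). -/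

import Mathlib

/-- ξ = exp(2πi/11), a primitive 11th root of unity. -/
noncomputable def ξ : ℂ := Complex.exp (2 * Real.pi * Complex.I / 11)

/-- ν = (−1 + i√11)/2. -/
noncomputable def ν : ℂ := (-1 + Complex.I * Real.sqrt 11) / 2

/-- ℤ[ν] = {a + bν : a, b ∈ ℤ} ⊂ ℂ. -/
noncomputable def Zν : Set ℂ := {z | ∃ a b : ℤ, z = (a : ℂ) + (b : ℂ) * ν}

/-- v_k = (ξ^k, ξ^{9k}, ξ^{3k}, ξ^{4k}, ξ^{5k}) ∈ ℂ⁵. -/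
noncomputable def v (k : ℕ) : Fin 5 → ℂ := fun i => ξ ^ (k * ![1, 9, 3, 4, 5] i)

/-- The linear form ℓ_k(z) = ξ^k z₁ + ξ^{9k} z₂ + ξ^{3k} z₃ + ξ^{4k} z₄ + ξ^{5k} z₅, k ∈ ℤ. -/
noncomputable def ℓ (k : ℤ) (z : Fin 5 → ℂ) : ℂ :=
  ∑ i : Fin 5, ξ ^ (k * ![1, 9, 3, 4, 5] i) * z i

theorem xi_ne_zero : ξ ≠ 0 := Complex.exp_ne_zero _

theorem xi_isPrimitiveRoot : IsPrimitiveRoot ξ 11 :=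
  Complex.isPrimitiveRoot_exp 11 (by norm_num)

theorem xi_pow_eleven : ξ ^ 11 = 1 :=
  xi_isPrimitiveRoot.pow_eq_one

/-- The Gaussian period `ξ + ξ³ + ξ⁴ + ξ⁵ + ξ⁹`. -/
noncomputable def period : ℂ := ξ + ξ ^ 3 + ξ ^ 4 + ξ ^ 5 + ξ ^ 9

theorem cyclotomic_relation {x : ℂ} (hx : IsPrimitiveRoot x 11) :
    1 + x + x ^ 2 + x ^ 3 + x ^ 4 + x ^ 5 + x ^ 6 + x ^ 7 + x ^ 8 + x ^ 9 + x ^ 10 = 0 := by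
  have h := hx.geom_sum_eq_zero (by norm_num)
  simpa [Finset.sum_range_succ] using h

theorem nu_sq : ν ^ 2 = -ν - 3 := by
  have h : ((Real.sqrt 11 : ℝ) : ℂ) ^ 2 = 11 := by
    rw [← Complex.ofReal_pow, Real.sq_sqrt (by norm_num)]
    norm_num
  unfold ν
  linear_combination (1 / 4 : ℂ) * (Real.sqrt 11 : ℂ) ^ 2 * Complex.I_sq - (1 / 4 : ℂ) * h

theorem Zν_add {x y : ℂ} (hx : x ∈ Zν) (hy : y ∈ Zν) : x + y ∈ Zν := by
  obtain ⟨a, b, rfl⟩ := hx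
  obtain ⟨c, d, rfl⟩ := hy
  exact ⟨a + c, b + d, by push_cast; ring⟩

theorem Zν_sub {x y : ℂ} (hx : x ∈ Zν) (hy : y ∈ Zν) : x - y ∈ Zν := by
  obtain ⟨a, b, rfl⟩ := hx
  obtain ⟨c, d, rfl⟩ := hy
  exact ⟨a - c, b - d, by push_cast; ring⟩

theorem Zν_mul {x y : ℂ} (hx : x ∈ Zν) (hy : y ∈ Zν) : x * y ∈ Zν := by
  obtain ⟨a, b, rfl⟩ := hx
  obtain ⟨c, d, rfl⟩ := hy
  exact ⟨a * c - 3 * b * d, a * d + b * c - b * d, by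
    push_cast
    linear_combination (b : ℂ) * d * nu_sq⟩

theorem period_sq : period ^ 2 + period + 3 = 0 := by
  have h := cyclotomic_relation xi_isPrimitiveRoot
  have h11 := xi_pow_eleven
  unfold period
  linear_combination 3 * h + (ξ ^ 7 + 2 * ξ ^ 3 + 2 * ξ ^ 2 + 2 * ξ) * h11

theorem period_mem : period ∈ Zν := by
  have h : (period - ν) * (period + 1 + ν) = 0 := by
    linear_combination period_sq - nu_sq
  rcases mul_eq_zero.mp h with h | h
  · exact ⟨0, 1, by push_cast; linear_combination h⟩
  · exact ⟨-1, -1, by push_cast; linear_combination h⟩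

theorem quintic_relation {x : ℂ} (hx : IsPrimitiveRoot x 11)
    (hp : period = x + x ^ 3 + x ^ 4 + x ^ 5 + x ^ 9) :
    x ^ 5 = period * x ^ 4 + x ^ 3 - x ^ 2 + (1 + period) * x + 1 := by
  rw [hp]
  linear_combination (-1 - x ^ 2 * (x - 1)) * cyclotomic_relation hx

theorem quintic_relation_conjugate (i : Fin 5) :
    (ξ ^ (![1, 9, 3, 4, 5] i : ℤ)) ^ 5 =
      period * (ξ ^ (![1, 9, 3, 4, 5] i : ℤ)) ^ 4 + (ξ ^ (![1, 9, 3, 4, 5] i : ℤ)) ^ 3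
        - (ξ ^ (![1, 9, 3, 4, 5] i : ℤ)) ^ 2
        + (1 + period) * ξ ^ (![1, 9, 3, 4, 5] i : ℤ) + 1 := by
  have key : ∀ r : ℕ, Nat.Coprime r 11 → period = ξ ^ r + (ξ ^ r) ^ 3 + (ξ ^ r) ^ 4
      + (ξ ^ r) ^ 5 + (ξ ^ r) ^ 9 → (ξ ^ (r : ℤ)) ^ 5 =
      period * (ξ ^ (r : ℤ)) ^ 4 + (ξ ^ (r : ℤ)) ^ 3 - (ξ ^ (r : ℤ)) ^ 2
        + (1 + period) * ξ ^ (r : ℤ) + 1 := by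
    intro r hr hp
    rw [zpow_natCast]
    exact quintic_relation (xi_isPrimitiveRoot.pow_of_coprime r hr) hp
  have red : ∀ n : ℕ, ξ ^ n = ξ ^ (n % 11) := fun n => pow_eq_pow_mod n xi_pow_eleven
  have period_eq : ∀ r ∈ [1, 9, 3, 4, 5], period = ξ ^ r + (ξ ^ r) ^ 3 + (ξ ^ r) ^ 4
      + (ξ ^ r) ^ 5 + (ξ ^ r) ^ 9 := by
    intro r hr
    simp only [← pow_mul]
    rw [red r, red (r * 3), red (r * 4), red (r * 5), red (r * 9)]
    unfold period
    fin_cases hr <;> norm_num <;> ring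
  fin_cases i
  · exact key 1 (by norm_num) (period_eq 1 (by simp))
  · exact key 9 (by norm_num) (period_eq 9 (by simp))
  · exact key 3 (by norm_num) (period_eq 3 (by simp))
  · exact key 4 (by norm_num) (period_eq 4 (by simp))
  · exact key 5 (by norm_num) (period_eq 5 (by simp))

theorem ℓ_recurrence (k : ℤ) (z : Fin 5 → ℂ) :
    ℓ (k + 5) z = period * ℓ (k + 4) z + ℓ (k + 3) z - ℓ (k + 2) z
      + (ℓ (k + 1) z + period * ℓ (k + 1) z) + ℓ k z := by
  have shift : ∀ (n : ℕ) (r : ℤ), ξ ^ ((k + n) * r) = ξ ^ (k * r) * (ξ ^ r) ^ n := by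
    intro n r
    rw [add_mul, zpow_add₀ xi_ne_zero, mul_comm (n : ℤ) r, zpow_mul ξ r, zpow_natCast]
  have s5 := shift 5
  have s4 := shift 4
  have s3 := shift 3
  have s2 := shift 2
  have s1 := shift 1
  push_cast at s5 s4 s3 s2 s1
  unfold ℓ
  simp only [Finset.mul_sum, ← Finset.sum_add_distrib, ← Finset.sum_sub_distrib]
  refine Finset.sum_congr rfl fun i _ => ?_
  rw [s5, s4, s3, s2, s1]
  linear_combination ξ ^ (k * ![1, 9, 3, 4, 5] i) * z i * quintic_relation_conjugate i

theorem ℓ_window (z : Fin 5 → ℂ) (h : ∀ k : ℤ, 0 ≤ k → k ≤ 4 → ℓ k z ∈ Zν) (k : ℤ) :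
    ℓ k z ∈ Zν ∧ ℓ (k + 1) z ∈ Zν ∧ ℓ (k + 2) z ∈ Zν ∧ ℓ (k + 3) z ∈ Zν ∧
      ℓ (k + 4) z ∈ Zν := by
  induction k using Int.induction_on with
  | zero => refine ⟨?_, ?_, ?_, ?_, ?_⟩ <;> exact h _ (by norm_num) (by norm_num)
  | succ n ih =>
    obtain ⟨h0, h1, h2, h3, h4⟩ := ih
    have h5 : ℓ ((n : ℤ) + 5) z ∈ Zν := by
      rw [ℓ_recurrence]
      exact Zν_add (Zν_add (Zν_sub (Zν_add (Zν_mul period_mem h4) h3) h2)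
        (Zν_add h1 (Zν_mul period_mem h1))) h0
    simp only [add_assoc]
    norm_num
    exact ⟨h1, h2, h3, h4, h5⟩
  | pred n ih =>
    obtain ⟨h0, h1, h2, h3, h4⟩ := ih
    have hr := ℓ_recurrence (-(n : ℤ) - 1) z
    rw [show -(n : ℤ) - 1 + 5 = -n + 4 by ring, show -(n : ℤ) - 1 + 4 = -n + 3 by ring,
      show -(n : ℤ) - 1 + 3 = -n + 2 by ring, show -(n : ℤ) - 1 + 2 = -n + 1 by ring,
      show -(n : ℤ) - 1 + 1 = -n by ring] at hr
    rw [show -(n : ℤ) - 1 + 4 = -n + 3 by ring,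
      show -(n : ℤ) - 1 + 3 = -n + 2 by ring, show -(n : ℤ) - 1 + 2 = -n + 1 by ring,
      show -(n : ℤ) - 1 + 1 = -n by ring]
    refine ⟨?_, h0, h1, h2, h3⟩
    rw [← sub_eq_iff_eq_add'.mpr hr]
    exact Zν_sub h4 (Zν_add (Zν_sub (Zν_add (Zν_mul period_mem h3) h2) h1)
      (Zν_add h0 (Zν_mul period_mem h0)))

/-- if ℓ_k(z) ∈ ℤ[ν] for k = 0,…,4 then ℓ_k(z) ∈ ℤ[ν] for every integer k;
i.e. Λ₄ is stable under M_τ = diag(ξ, ξ⁹, ξ³, ξ⁴, ξ⁵). -/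
theorem Lambda4_stable (z : Fin 5 → ℂ)
    (h : ∀ k : ℤ, 0 ≤ k → k ≤ 4 → ℓ k z ∈ Zν) :
    ∀ k : ℤ, ℓ k z ∈ Zν := by
  exact fun k => (ℓ_window z h k).1
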